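/- Let N be an odd positive integer and 𝔞 ∈ 𝔈₂. Then for every matrix B ∈ SL₂(ℤ), the function τ ↦ W_𝔞(B·τ) has a q-expansion with coefficients in ℤ[ζ]: there exist an integer n₀ and a sequence (c_n)_{n∈ℤ} of elements of ℤ[ζ] with c_n = 0 for n < n₀, such that W_𝔞(B·τ) = Σ_{n≥n₀} c_n q^n for all τ in the upper half-plane, where q = e^{2πiτ/N} and ζ = e^{2πi/N}. -/

import Mathlib

open scoped MatrixGroups
open Complex

/-- The Weierstrass ℘-function of the lattice `L_τ = ℤ + ℤτ`. -/
noncomputable def wp (τ z : ℂ) : ℂ :=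
  1 / z ^ 2 + ∑' p : {p : ℤ × ℤ // p ≠ 0},
    (1 / (z - ((p.1.1 : ℂ) + (p.1.2 : ℂ) * τ)) ^ 2 - 1 / ((p.1.1 : ℂ) + (p.1.2 : ℂ) * τ) ^ 2)

/-- The function `W_𝔞` for the triple `𝔞 = [a₁,a₂,a₃]`. -/
noncomputable def Wfun (N : ℕ) (a₁ a₂ a₃ : ℤ) (τ : ℂ) : ℂ :=
  (wp τ ((a₁ : ℂ) / N) - wp τ ((a₃ : ℂ) / N)) / (wp τ ((a₂ : ℂ) / N) - wp τ ((a₃ : ℂ) / N))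

/-- Möbius action of an integral 2×2 matrix on ℂ. -/
noncomputable def moebius (A : Matrix (Fin 2) (Fin 2) ℤ) (τ : ℂ) : ℂ :=
  ((A 0 0 : ℂ) * τ + (A 0 1 : ℂ)) / ((A 1 0 : ℂ) * τ + (A 1 1 : ℂ))

/-- `𝔖_N = (ℤ/Nℤ)ˣ/{±1}`. -/
abbrev SNgroup (N : ℕ) := (ZMod N)ˣ ⧸ (Subgroup.closure ({-1} : Set (ZMod N)ˣ))

/-- The triple `𝔞 = [a₁,a₂,a₃]` is in `𝔈`. -/
def memE (N : ℕ) (a : ℤ × ℤ × ℤ) : Prop :=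
  0 < a.1 ∧ 0 < a.2.1 ∧ 0 < a.2.2 ∧ 2 * a.1 ≤ (N : ℤ) ∧ 2 * a.2.1 ≤ (N : ℤ) ∧
    2 * a.2.2 ≤ (N : ℤ) ∧ a.1 ≠ a.2.1 ∧ a.1 ≠ a.2.2 ∧ a.2.1 ≠ a.2.2

def memE1 (N : ℕ) (a : ℤ × ℤ × ℤ) : Prop :=
  memE N a ∧ IsCoprime (a.1 * a.2.1 * a.2.2) (N : ℤ)

def memE2 (N : ℕ) (a : ℤ × ℤ × ℤ) : Prop :=
  memE1 N a ∧ IsCoprime (a.1 - a.2.2) (N : ℤ) ∧ IsCoprime (a.1 + a.2.2) (N : ℤ) ∧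
    IsCoprime (a.2.1 - a.2.2) (N : ℤ) ∧ IsCoprime (a.2.1 + a.2.2) (N : ℤ)

/-- `M` is a lift to `Γ₀(N)` of `diag(λ⁻¹, λ)` for the class `s = λ ∈ 𝔖_N`. -/
def IsDiagLift (N : ℕ) (M : SL(2, ℤ)) (s : SNgroup N) : Prop :=
  ∃ u : (ZMod N)ˣ, (QuotientGroup.mk u : SNgroup N) = s ∧
    ((M 0 0 : ℤ) : ZMod N) = ((u⁻¹ : (ZMod N)ˣ) : ZMod N) ∧
    ((M 0 1 : ℤ) : ZMod N) = 0 ∧ ((M 1 0 : ℤ) : ZMod N) = 0 ∧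
    ((M 1 1 : ℤ) : ZMod N) = (u : ZMod N)

/-- The function `T_{𝔄,F}`. -/
noncomputable def Tfun (N : ℕ) {n : ℕ} (A : Fin n → ℤ × ℤ × ℤ)
    (F : MvPolynomial (Fin n) ℤ) (M : SNgroup N → SL(2, ℤ)) (τ : ℂ) : ℂ :=
  ∑ᶠ s : SNgroup N, MvPolynomial.aeval
    (fun i => Wfun N (A i).1 (A i).2.1 (A i).2.2 (moebius ((M s : SL(2, ℤ)) : Matrix (Fin 2) (Fin 2) ℤ) τ)) F

/-- The matrix `B(t,u,v,k)`. -/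
def Bmat (t : ℕ) (u v k : ℤ) : Matrix (Fin 2) (Fin 2) ℤ :=
  !![u, (u * v - 1) / (t : ℤ) + u * k; (t : ℤ), v + (t : ℤ) * k]

/-- `{a}` : the representative of `±a mod N` in `(0, N/2]` (paper's `{·}`). -/
def red (N : ℕ) (a : ℤ) : ℤ :=
  if 2 * (a % (N : ℤ)) ≤ (N : ℤ) then a % (N : ℤ) else (N : ℤ) - a % (N : ℤ)

/-- `μ(a) ∈ {±1}` with `a ≡ μ(a){a} mod N`. -/
def muSign (N : ℕ) (a : ℤ) : ℤ :=
  if 2 * (a % (N : ℤ)) ≤ (N : ℤ) then 1 else -1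

/-- `φ_s(τ) = (2πi)⁻²℘(s/N; L_τ) − 1/12`. -/
noncomputable def phiFun (N : ℕ) (s : ℤ) (τ : ℂ) : ℂ :=
  (1 / (2 * (Real.pi : ℂ) * Complex.I) ^ 2) * wp τ ((s : ℂ) / N) - 1 / 12

/-- `f[A]₂` : weight-2 slash of `φ_s`. -/
noncomputable def phiSlash (N : ℕ) (s : ℤ) (A : Matrix (Fin 2) (Fin 2) ℤ) (τ : ℂ) : ℂ :=
  phiFun N s (moebius A τ) * ((A 1 0 : ℂ) * τ + (A 1 1 : ℂ)) ^ (-2 : ℤ)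

/-- `q = e^{2πiτ/N}`. -/
noncomputable def qq (N : ℕ) (τ : ℂ) : ℂ :=
  Complex.exp (2 * (Real.pi : ℂ) * Complex.I * τ / N)

/-- `ζ = e^{2πi/N}`. -/
noncomputable def zetaN (N : ℕ) : ℂ :=
  Complex.exp (2 * (Real.pi : ℂ) * Complex.I / N)

/-- `θ_{a,b} = ζ^a(1−ζ^{b−a})(1−ζ^{b+a})/((1−ζ^a)²(1−ζ^b)²)`. -/
noncomputable def theta (ζ : ℂ) (a b : ℤ) : ℂ :=
  ζ ^ a * (1 - ζ ^ (b - a)) * (1 - ζ ^ (b + a)) / ((1 - ζ ^ a) ^ 2 * (1 - ζ ^ b) ^ 2)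

open Filter Topology Asymptotics

/-- The `q`-Pochhammer symbol `(u; Q)_∞ = ∏ₙ (1 - Qⁿ u)`. -/
noncomputable def qPoch (Q u : ℂ) : ℂ := ∏' n : ℕ, (1 - Q ^ n * u)

lemma summable_norm_qPoch {Q : ℂ} (hQ : ‖Q‖ < 1) (u : ℂ) :
    Summable fun n : ℕ ↦ ‖-(Q ^ n * u)‖ := by
  simpa using (summable_geometric_of_lt_one (norm_nonneg _) hQ).mul_right ‖u‖

lemma multipliable_qPoch {Q : ℂ} (hQ : ‖Q‖ < 1) (u : ℂ) :
    Multipliable fun n : ℕ ↦ 1 - Q ^ n * u := by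
  simpa [sub_eq_add_neg] using multipliable_one_add_of_summable (summable_norm_qPoch hQ u)

lemma qPoch_eq_mul {Q : ℂ} (hQ : ‖Q‖ < 1) (u : ℂ) :
    qPoch Q u = (1 - u) * qPoch Q (Q * u) := by
  have h := multipliable_qPoch hQ (Q * u)
  rw [qPoch, tprod_eq_zero_mul']
  · simp [qPoch, pow_succ, mul_assoc]
  · simpa [pow_succ, mul_assoc] using h

lemma qPoch_eq_prod_mul {Q : ℂ} (hQ : ‖Q‖ < 1) (u : ℂ) (k : ℕ) :
    qPoch Q u = (∏ n ∈ Finset.range k, (1 - Q ^ n * u)) * qPoch Q (Q ^ k * u) := by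
  induction k with
  | zero => simp
  | succ k ih =>
    rw [ih, qPoch_eq_mul hQ (Q ^ k * u), Finset.prod_range_succ, pow_succ' Q k]
    ring_nf

lemma qPoch_ne_zero {Q u : ℂ} (hQ : ‖Q‖ < 1) (h : ∀ n : ℕ, Q ^ n * u ≠ 1) : qPoch Q u ≠ 0 := by
  have := tprod_one_add_ne_zero_of_summable (f := fun n : ℕ ↦ -(Q ^ n * u))
    (fun n ↦ by rw [← sub_eq_add_neg, sub_ne_zero]; exact (h n).symm) (summable_norm_qPoch hQ u)
  simpa [qPoch, sub_eq_add_neg] using this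

lemma norm_qPoch_sub_one_le {Q u : ℂ} (hQ : ‖Q‖ ≤ 1 / 2) (hu : ‖u‖ ≤ 1 / 2) :
    ‖qPoch Q u - 1‖ ≤ 4 * ‖u‖ := by
  have hQ' : ‖Q‖ < 1 := by linarith
  have hlim := ((multipliable_qPoch hQ' u).hasProd.sub_const 1).norm
  refine le_of_tendsto hlim (.of_forall fun s ↦ ?_)
  have h1 := s.norm_prod_one_add_sub_one_le fun n ↦ -(Q ^ n * u)
  simp only [← sub_eq_add_neg] at h1
  have h2 : ∑ i ∈ s, ‖-(Q ^ i * u)‖ ≤ 2 * ‖u‖ := by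
    refine ((summable_norm_qPoch hQ' u).sum_le_tsum s fun _ _ ↦ norm_nonneg _).trans ?_
    simp only [norm_neg, norm_mul, norm_pow, tsum_mul_right,
      tsum_geometric_of_lt_one (norm_nonneg _) hQ']
    gcongr
    rw [inv_le_comm₀ (by linarith) (by norm_num)]
    linarith
  have h3 := Real.abs_exp_sub_one_le (x := ∑ i ∈ s, ‖-(Q ^ i * u)‖)
    (by rw [abs_of_nonneg (by positivity)]; linarith)
  rw [abs_of_nonneg (a := ∑ i ∈ s, _) (by positivity)] at h3
  linarith [le_abs_self (Real.exp (∑ i ∈ s, ‖-(Q ^ i * u)‖) - 1)]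

/-- Joint holomorphy of the `q`-Pochhammer symbol, along a holomorphic curve. -/
lemma differentiableOn_qPoch_comp {s : Set ℂ} (hs : IsOpen s) {f g : ℂ → ℂ}
    (hf : DifferentiableOn ℂ f s) (hg : DifferentiableOn ℂ g s) (hf1 : ∀ z ∈ s, ‖f z‖ < 1) :
    DifferentiableOn ℂ (fun z ↦ qPoch (f z) (g z)) s := by
  intro z hz
  obtain ⟨r, hr, hr1⟩ := exists_between (hf1 z hz)
  have hr0 : 0 ≤ r := (norm_nonneg _).trans hr.le
  obtain ⟨t, hts, ht, hzt⟩ : ∃ t ⊆ s, IsOpen t ∧ z ∈ t ∧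
      ∀ x ∈ t, ‖f x‖ ≤ r ∧ ‖g x‖ ≤ ‖g z‖ + 1 := by
    have h1 := (hf.continuousOn.continuousAt (hs.mem_nhds hz)).norm.eventually (gt_mem_nhds hr)
    have h2 := (hg.continuousOn.continuousAt (hs.mem_nhds hz)).norm.eventually
      (gt_mem_nhds (lt_add_one _))
    obtain ⟨t, h, ht, hzt⟩ := eventually_nhds_iff.mp (h1.and (h2.and (hs.mem_nhds hz)))
    exact ⟨t, fun x hx ↦ (h x hx).2.2, ht, hzt, fun x hx ↦ ⟨(h x hx).1.le, (h x hx).2.1.le⟩⟩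
  have hprod := Summable.hasProdLocallyUniformlyOn_nat_one_add (f := fun n x ↦ -(f x ^ n * g x)) ht
    ((summable_geometric_of_lt_one hr0 hr1).mul_right (‖g z‖ + 1))
    (.of_forall fun n x hx ↦ by
      obtain ⟨h1, h2⟩ := hzt.2 x hx
      rw [norm_neg, norm_mul, norm_pow]
      gcongr)
    (fun n ↦ ((((hf.mono hts).pow n).mul (hg.mono hts)).neg).continuousOn)
  have := hprod.differentiableOn (.of_forall fun n ↦ by
    simpa [Finset.prod_fn] using DifferentiableOn.finsetProd fun i _ ↦
      (((((hf.mono hts).pow i).mul (hg.mono hts)).neg).const_add 1)) ht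
  refine (((this.congr fun x hx ↦ ?_).differentiableAt (ht.mem_nhds hzt.1))).differentiableWithinAt
  simp [qPoch, sub_eq_add_neg]

lemma differentiable_qPoch {Q : ℂ} (hQ : ‖Q‖ < 1) : Differentiable ℂ (qPoch Q) := by
  rw [← differentiableOn_univ]
  exact differentiableOn_qPoch_comp isOpen_univ (differentiableOn_const Q) differentiableOn_id
    fun _ _ ↦ hQ

/-- The multiplicative theta function `∏ₙ (1 - Qⁿ u) (1 - Qⁿ⁺¹ / u)`. -/
noncomputable def thetaProd (Q u : ℂ) : ℂ := qPoch Q u * qPoch Q (Q / u)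

lemma thetaProd_mul {Q u : ℂ} (hQ : ‖Q‖ < 1) (hQ0 : Q ≠ 0) (hu : u ≠ 0) :
    thetaProd Q (Q * u) = -u⁻¹ * thetaProd Q u := by
  rw [thetaProd, thetaProd, qPoch_eq_mul hQ u, show Q / (Q * u) = u⁻¹ by field_simp,
    qPoch_eq_mul hQ u⁻¹, ← div_eq_mul_inv]
  field_simp
  ring

lemma thetaProd_inv {Q u : ℂ} (hQ : ‖Q‖ < 1) (hu : u ≠ 0) :
    thetaProd Q u⁻¹ = -u⁻¹ * thetaProd Q u := by
  rw [thetaProd, thetaProd, qPoch_eq_mul hQ u, qPoch_eq_mul hQ u⁻¹, ← div_eq_mul_inv,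
    div_inv_eq_mul]
  field_simp
  ring

lemma thetaProd_ne_zero {Q u : ℂ} (hQ : ‖Q‖ < 1) (hu : u ≠ 0) (h : ∀ n : ℤ, u ≠ Q ^ n) :
    thetaProd Q u ≠ 0 := by
  refine mul_ne_zero (qPoch_ne_zero hQ fun n hn ↦ h (-n) ?_) (qPoch_ne_zero hQ fun n hn ↦
    h (n + 1 : ℕ) ?_)
  · rw [zpow_neg, zpow_natCast]
    exact eq_inv_of_mul_eq_one_right hn
  · rw [zpow_natCast, pow_succ]
    field_simp at hn
    exact hn.symm

/-- The exponential `e(z) = exp (2πiz)`. -/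
noncomputable def cexpTwoPi (z : ℂ) : ℂ := exp (2 * Real.pi * I * z)

local notation "𝐞" => cexpTwoPi

lemma cexpTwoPi_ne_zero (z : ℂ) : 𝐞 z ≠ 0 := exp_ne_zero _

lemma cexpTwoPi_add (z w : ℂ) : 𝐞 (z + w) = 𝐞 z * 𝐞 w := by
  rw [cexpTwoPi, mul_add, exp_add]; rfl

lemma cexpTwoPi_neg (z : ℂ) : 𝐞 (-z) = (𝐞 z)⁻¹ := by
  rw [cexpTwoPi, mul_neg, exp_neg]; rfl

lemma cexpTwoPi_sub (z w : ℂ) : 𝐞 (z - w) = 𝐞 z / 𝐞 w := by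
  rw [sub_eq_add_neg, cexpTwoPi_add, cexpTwoPi_neg, div_eq_mul_inv]

@[simp] lemma cexpTwoPi_zero : 𝐞 0 = 1 := by simp [cexpTwoPi]

@[simp] lemma cexpTwoPi_one : 𝐞 1 = 1 := by simp [cexpTwoPi]

lemma cexpTwoPi_int_mul (n : ℤ) (z : ℂ) : 𝐞 (n * z) = 𝐞 z ^ n := by
  rw [cexpTwoPi, cexpTwoPi, ← exp_int_mul]; ring_nf

lemma cexpTwoPi_eq_iff {z w : ℂ} : 𝐞 z = 𝐞 w ↔ ∃ n : ℤ, z = w + n := by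
  rw [cexpTwoPi, cexpTwoPi, exp_eq_exp_iff_exists_int]
  refine exists_congr fun n ↦ ?_
  rw [show 2 * Real.pi * I * w + n * (2 * Real.pi * I) = 2 * Real.pi * I * (w + n) by ring]
  exact mul_right_inj' two_pi_I_ne_zero

lemma norm_cexpTwoPi_lt_one {τ : ℂ} (hτ : 0 < τ.im) : ‖𝐞 τ‖ < 1 := by
  rw [cexpTwoPi, norm_exp, Real.exp_lt_one_iff]
  simp
  positivity

@[fun_prop] lemma differentiable_cexpTwoPi : Differentiable ℂ cexpTwoPi := by
  unfold cexpTwoPi; fun_prop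

/-- The pair of periods `1, τ`. -/
noncomputable def stdPeriodPair (τ : ℂ) (hτ : 0 < τ.im) : PeriodPair where
  ω₁ := 1
  ω₂ := τ
  indep := by
    rw [LinearIndependent.pair_iff]
    intro s t h
    have h1 := congrArg im h
    have h2 := congrArg re h
    simp only [add_im, smul_im, one_im, add_re, smul_re, one_re, smul_eq_mul, mul_zero, mul_one,
      zero_add, zero_im, zero_re] at h1 h2
    have ht : t = 0 := by simpa [hτ.ne'] using h1
    simpa [ht] using h2

lemma mem_stdPeriodPair_lattice {τ : ℂ} (hτ : 0 < τ.im) {z : ℂ} :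
    z ∈ (stdPeriodPair τ hτ).lattice ↔ ∃ m n : ℤ, (m : ℂ) + n * τ = z := by
  simp [PeriodPair.mem_lattice, stdPeriodPair]

/-- The theta function in the additive variable. -/
noncomputable def thetaAdd (τ z : ℂ) : ℂ := thetaProd (𝐞 τ) (𝐞 z)

section thetaAdd

variable {τ : ℂ} (hτ : 0 < τ.im)

include hτ in
lemma differentiable_thetaAdd : Differentiable ℂ (thetaAdd τ) := by
  have h := differentiable_qPoch (norm_cexpTwoPi_lt_one hτ)
  have h2 : Differentiable ℂ fun z ↦ 𝐞 τ / 𝐞 z :=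
    (differentiable_const _).div differentiable_cexpTwoPi cexpTwoPi_ne_zero
  exact (h.comp differentiable_cexpTwoPi).mul (h.comp h2)

lemma thetaAdd_add_one (τ z : ℂ) : thetaAdd τ (z + 1) = thetaAdd τ z := by
  simp [thetaAdd, cexpTwoPi_add]

include hτ in
lemma thetaAdd_add_self (z : ℂ) : thetaAdd τ (z + τ) = -(𝐞 z)⁻¹ * thetaAdd τ z := by
  rw [thetaAdd, cexpTwoPi_add, mul_comm, thetaProd_mul (norm_cexpTwoPi_lt_one hτ)
    (cexpTwoPi_ne_zero _) (cexpTwoPi_ne_zero _)]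
  rfl

include hτ in
lemma thetaAdd_neg (z : ℂ) : thetaAdd τ (-z) = -(𝐞 z)⁻¹ * thetaAdd τ z := by
  rw [thetaAdd, cexpTwoPi_neg, thetaProd_inv (norm_cexpTwoPi_lt_one hτ) (cexpTwoPi_ne_zero _)]
  rfl

lemma thetaAdd_ne_zero {z : ℂ} (hz : z ∉ (stdPeriodPair τ hτ).lattice) : thetaAdd τ z ≠ 0 := by
  refine thetaProd_ne_zero (norm_cexpTwoPi_lt_one hτ) (cexpTwoPi_ne_zero _) fun n hn ↦ hz ?_
  rw [← cexpTwoPi_int_mul, cexpTwoPi_eq_iff] at hn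
  obtain ⟨m, rfl⟩ := hn
  exact (mem_stdPeriodPair_lattice hτ).mpr ⟨m, n, add_comm _ _⟩

include hτ in
lemma thetaAdd_eq_mul (z : ℂ) :
    thetaAdd τ z = (1 - 𝐞 z) * (qPoch (𝐞 τ) (𝐞 τ * 𝐞 z) * qPoch (𝐞 τ) (𝐞 τ / 𝐞 z)) := by
  rw [thetaAdd, thetaProd, qPoch_eq_mul (norm_cexpTwoPi_lt_one hτ) (𝐞 z), mul_assoc]

include hτ in
lemma thetaAdd_zero : thetaAdd τ 0 = 0 := by simp [thetaAdd_eq_mul hτ]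

include hτ in
lemma deriv_thetaAdd_zero_ne_zero : deriv (thetaAdd τ) 0 ≠ 0 := by
  have hQ := norm_cexpTwoPi_lt_one hτ
  have hP := differentiable_qPoch hQ
  have h1 : HasDerivAt (fun z ↦ 1 - 𝐞 z) (-(2 * Real.pi * I)) 0 := by
    have : HasDerivAt (fun z : ℂ ↦ exp (2 * Real.pi * I * z)) (2 * Real.pi * I) 0 := by
      simpa using ((hasDerivAt_id (0 : ℂ)).const_mul (2 * Real.pi * I)).cexp
    exact this.const_sub 1
  have h2 : DifferentiableAt ℂ
      (fun z ↦ qPoch (𝐞 τ) (𝐞 τ * 𝐞 z) * qPoch (𝐞 τ) (𝐞 τ / 𝐞 z)) 0 :=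
    ((hP.comp (differentiable_cexpTwoPi.const_mul _)).mul
      (hP.comp ((differentiable_const _).div differentiable_cexpTwoPi cexpTwoPi_ne_zero))) 0
  have h3 := h1.mul h2.hasDerivAt
  have h4 : qPoch (𝐞 τ) (𝐞 τ) ≠ 0 := by
    refine qPoch_ne_zero hQ fun n hn ↦ ?_
    have := congrArg norm hn
    rw [norm_mul, norm_pow, norm_one, ← pow_succ] at this
    exact (pow_lt_one₀ (norm_nonneg _) hQ n.succ_ne_zero).ne this
  rw [funext (thetaAdd_eq_mul hτ)]
  refine ne_of_eq_of_ne h3.deriv ?_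
  simp [h4, Real.pi_ne_zero]

end thetaAdd

lemma AnalyticAt.dslope_same {f : ℂ → ℂ} {a : ℂ} (hf : AnalyticAt ℂ f a) :
    AnalyticAt ℂ (dslope f a) a := by
  obtain ⟨p, hp⟩ := hf
  exact hp.has_fpower_series_dslope_fslope.analyticAt

/-- An even function analytic at `0` agrees with its value there to second order. -/
lemma AnalyticAt.exists_eq_add_sq_mul_of_even {f : ℂ → ℂ} (hf : AnalyticAt ℂ f 0)
    (heven : ∀ z, f (-z) = f z) :
    ∃ k : ℂ → ℂ, AnalyticAt ℂ k 0 ∧ ∀ z, f z = f 0 + z ^ 2 * k z := by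
  refine ⟨dslope (dslope f 0) 0, hf.dslope_same.dslope_same, fun z ↦ ?_⟩
  have h0 : deriv f 0 = 0 := by
    have := deriv_comp_neg f 0
    simp only [heven, neg_zero] at this
    exact self_eq_neg.mp this
  have h1 := sub_smul_dslope f 0 z
  have h2 := sub_smul_dslope (dslope f 0) 0 z
  simp only [sub_zero, smul_eq_mul, _root_.dslope_same, h0] at h1 h2
  rw [pow_two, mul_assoc, h2, h1]
  ring

open PeriodPair in
/-- The difference `℘(z) - ℘(w)` is a nonzero multiple of a quotient of theta functions. -/
theorem exists_thetaAdd_quotient_eq {τ : ℂ} (hτ : 0 < τ.im) {w : ℂ}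
    (hw : w ∉ (stdPeriodPair τ hτ).lattice) :
    ∃ c : ℂ, c ≠ 0 ∧ ∀ z ∉ (stdPeriodPair τ hτ).lattice,
      thetaAdd τ (z + w) * thetaAdd τ (z - w) / thetaAdd τ z ^ 2 =
        c * (℘[stdPeriodPair τ hτ] z - ℘[stdPeriodPair τ hτ] w) := by
  classical
  set L := stdPeriodPair τ hτ with hL
  have hT := differentiable_thetaAdd hτ
  have hTa (z : ℂ) : AnalyticAt ℂ (thetaAdd τ) z := hT.analyticAt z
  have hT0 : ∀ z ∉ L.lattice, thetaAdd τ z ≠ 0 := fun z hz ↦ thetaAdd_ne_zero hτ hz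
  set num : ℂ → ℂ := fun z ↦ thetaAdd τ (z + w) * thetaAdd τ (z - w) with hnum
  have hnuma (z : ℂ) : AnalyticAt ℂ num z := by
    have : Differentiable ℂ num :=
      (hT.comp (differentiable_id.add_const w)).mul (hT.comp (differentiable_id.sub_const w))
    exact this.analyticAt z
  set s := dslope (thetaAdd τ) 0 with hs
  have hs0 : s 0 ≠ 0 := by
    rw [hs, dslope_same]
    exact deriv_thetaAdd_zero_ne_zero hτ
  have hsmul (z : ℂ) : z * s z = thetaAdd τ z := by
    simpa [thetaAdd_zero hτ] using sub_smul_dslope (thetaAdd τ) 0 z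
  set h : ℂ → ℂ := fun z ↦ num z / s z ^ 2 with hh
  have hha : AnalyticAt ℂ h 0 :=
    (hnuma 0).div ((hTa 0).dslope_same.pow 2) (pow_ne_zero 2 hs0)
  have hheven (z : ℂ) : h (-z) = h z := by
    have h1 : num (-z) = (𝐞 z)⁻¹ ^ 2 * num z := by
      simp only [hnum]
      rw [show -z + w = -(z - w) by ring, show -z - w = -(z + w) by ring, thetaAdd_neg hτ,
        thetaAdd_neg hτ, cexpTwoPi_add, cexpTwoPi_sub]
      field_simp [cexpTwoPi_ne_zero]
    have h2 : s (-z) = (𝐞 z)⁻¹ * s z := by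
      rcases eq_or_ne z 0 with rfl | hz
      · simp
      · apply mul_left_cancel₀ (neg_ne_zero.mpr hz)
        rw [hsmul, thetaAdd_neg hτ, ← hsmul z]
        ring
    simp only [hh, h1, h2, mul_pow]
    exact mul_div_mul_left _ _ (pow_ne_zero 2 (inv_ne_zero (cexpTwoPi_ne_zero z)))
  obtain ⟨k, hka, hk⟩ := hha.exists_eq_add_sq_mul_of_even hheven
  have hhT (z : ℂ) (hz : z ≠ 0) : num z / thetaAdd τ z ^ 2 = h z / z ^ 2 := by
    rw [← hsmul z]
    simp only [hh]
    field_simp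
  have hc : h 0 ≠ 0 := by
    refine div_ne_zero (mul_ne_zero ?_ ?_) (pow_ne_zero 2 hs0)
    · simpa using hT0 w hw
    · simpa using hT0 (-w) (by simpa using hw)
  set D : ℂ → ℂ := fun z ↦
    if z ∈ L.lattice then k 0 else num z / thetaAdd τ z ^ 2 - h 0 * ℘[L] z with hD
  have hD0 : AnalyticAt ℂ D 0 := by
    have : AnalyticAt ℂ (fun z ↦ k z - h 0 * ℘[L - (0 : ℂ)] z) 0 :=
      hka.sub (analyticAt_const.mul (L.analyticAt_weierstrassPExcept 0))
    refine this.congr ?_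
    filter_upwards [L.compl_lattice_sdiff_singleton_mem_nhds 0] with z hz
    rcases eq_or_ne z 0 with rfl | hz0
    · simp [hD]
    · have hzL : z ∉ L.lattice := by simp_all
      have hP := L.weierstrassPExcept_def 0 z
      simp only [ZeroMemClass.coe_zero] at hP
      simp only [hD, hzL, if_false]
      rw [hhT z hz0, hk z, hP]
      field_simp
      ring
  have hper {l : ℂ} (hl : l ∈ L.lattice)
      (hg : ∀ z, num (z + l) / thetaAdd τ (z + l) ^ 2 = num z / thetaAdd τ z ^ 2) :
      Function.Periodic D l := fun z ↦ by
    have h1 : z + l ∈ L.lattice ↔ z ∈ L.lattice := L.lattice.add_mem_iff_left hl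
    have h2 : ℘[L] (z + l) = ℘[L] z := L.weierstrassP_add_coe z ⟨l, hl⟩
    simp only [hD, h1, h2, hg]
  have hper1 : Function.Periodic D 1 := by
    refine hper ((mem_stdPeriodPair_lattice hτ).mpr ⟨1, 0, by simp⟩) fun z ↦ ?_
    simp only [hnum]
    rw [add_right_comm, add_sub_right_comm]
    simp only [thetaAdd_add_one]
  have hperτ : Function.Periodic D τ := by
    refine hper ((mem_stdPeriodPair_lattice hτ).mpr ⟨0, 1, by simp⟩) fun z ↦ ?_
    simp only [hnum]
    rw [add_right_comm, add_sub_right_comm]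
    simp only [thetaAdd_add_self hτ, cexpTwoPi_add, cexpTwoPi_sub]
    have := cexpTwoPi_ne_zero z
    have := cexpTwoPi_ne_zero w
    rw [mul_pow, ← mul_div_mul_left (thetaAdd τ (z + w) * thetaAdd τ (z - w)) _
      (pow_ne_zero 2 (neg_ne_zero.mpr (inv_ne_zero (cexpTwoPi_ne_zero z))))]
    congr 1
    field_simp
  have hperL {l : ℂ} (hl : l ∈ L.lattice) : Function.Periodic D l := by
    obtain ⟨m, n, rfl⟩ := (mem_stdPeriodPair_lattice hτ).mp hl
    simpa using (hper1.int_mul m).add_period (hperτ.int_mul n)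
  have hDa (z : ℂ) : DifferentiableAt ℂ D z := by
    by_cases hz : z ∈ L.lattice
    · have h1 : DifferentiableAt ℂ D (z - z) := by simpa using hD0.differentiableAt
      have h2 := h1.comp (f := fun y ↦ y - z) z (differentiableAt_id.sub_const z)
      refine h2.congr_of_eventuallyEq (.of_forall fun x ↦ ?_)
      exact ((hperL hz).sub_eq x).symm
    · have h1 : AnalyticAt ℂ (fun z ↦ num z / thetaAdd τ z ^ 2 - h 0 * ℘[L] z) z :=
        ((hnuma z).div ((hTa z).pow 2) (pow_ne_zero 2 (hT0 z hz))).sub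
          (analyticAt_const.mul (L.analyticOnNhd_weierstrassP z hz))
      refine h1.differentiableAt.congr_of_eventuallyEq ?_
      filter_upwards [L.isClosed_lattice.isOpen_compl.mem_nhds hz] with x hx
      simp only [hD]
      exact if_neg hx
  have hconst (z : ℂ) : D z = D w :=
    Differentiable.apply_eq_apply_of_bounded hDa
      (IsZLattice.isCompact_range_of_periodic L.lattice _ (Differentiable.continuous hDa)
        fun z l hl ↦ hperL hl z).isBounded z w
  refine ⟨h 0, hc, fun z hz ↦ ?_⟩
  have h1 := hconst z
  have h2 : num w = 0 := by simp [hnum, thetaAdd_zero hτ]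
  simp only [hD, hz, hw, if_false, h2] at h1
  rw [mul_sub]
  linear_combination h1

section wp

variable {τ : ℂ} (hτ : 0 < τ.im)

lemma stdPeriodPair_latticeEquivProd_symm (p : ℤ × ℤ) :
    ((stdPeriodPair τ hτ).latticeEquivProd.symm p : ℂ) = p.1 + p.2 * τ := by
  rw [PeriodPair.latticeEquiv_symm_apply]
  simp [stdPeriodPair]

open PeriodPair in
lemma wp_eq_weierstrassP (z : ℂ) : wp τ z = ℘[stdPeriodPair τ hτ] z := by
  classical
  set L := stdPeriodPair τ hτ
  set f : ℤ × ℤ → ℂ := fun p ↦ 1 / (z - ((p.1 : ℂ) + p.2 * τ)) ^ 2 - 1 / ((p.1 : ℂ) + p.2 * τ) ^ 2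
  have hf : HasSum f (℘[L] z) := by
    rw [← L.latticeEquivProd.symm.toEquiv.hasSum_iff.mpr (L.hasSum_weierstrassP z) |>.tsum_eq]
    have := (L.latticeEquivProd.symm.toEquiv.hasSum_iff.mpr (L.hasSum_weierstrassP z)).summable
    convert this.hasSum using 1
    ext p
    simp [f, L, stdPeriodPair_latticeEquivProd_symm hτ p]
  have h1 : ∑' p : {p : ℤ × ℤ // p ≠ 0}, f p = ∑' p, if p = 0 then 0 else f p := by
    refine (tsum_subtype {p : ℤ × ℤ | p ≠ 0} f).trans (tsum_congr fun p ↦ ?_)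
    by_cases hp : p = 0 <;> simp [Set.indicator, hp]
  rw [← hf.tsum_eq, hf.summable.tsum_eq_add_tsum_ite 0, ← h1]
  simp [wp, f]

include hτ in
lemma wp_eq_tsum (z : ℂ) : wp τ z =
    ∑' p : ℤ × ℤ, (1 / (z - ((p.1 : ℂ) + p.2 * τ)) ^ 2 - 1 / ((p.1 : ℂ) + p.2 * τ) ^ 2) := by
  set L := stdPeriodPair τ hτ
  rw [wp_eq_weierstrassP hτ, PeriodPair.weierstrassP, ← L.latticeEquivProd.symm.toEquiv.tsum_eq]
  refine tsum_congr fun p ↦ ?_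
  simp [L, stdPeriodPair_latticeEquivProd_symm hτ p]

include hτ in
lemma denom_moebius_ne_zero (B : SL(2, ℤ)) : (B 1 0 : ℂ) * τ + B 1 1 ≠ 0 := by
  simpa [UpperHalfPlane.denom] using UpperHalfPlane.denom_ne_zero (B : GL (Fin 2) ℝ) ⟨τ, hτ⟩

include hτ in
lemma moebius_im_pos (B : SL(2, ℤ)) : 0 < (moebius (B : Matrix (Fin 2) (Fin 2) ℤ) τ).im := by
  have := (B • (⟨τ, hτ⟩ : UpperHalfPlane)).im_pos
  rw [UpperHalfPlane.specialLinearGroup_apply] at this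
  simpa [moebius] using this

/-- Reindexing of `ℤ × ℤ` by a matrix in `SL₂(ℤ)`. -/
def sl2Reindex (B : SL(2, ℤ)) : ℤ × ℤ ≃ ℤ × ℤ where
  toFun p := (p.1 * B 1 1 + p.2 * B 0 1, p.1 * B 1 0 + p.2 * B 0 0)
  invFun p := (p.1 * B 0 0 - p.2 * B 0 1, p.2 * B 1 1 - p.1 * B 1 0)
  left_inv p := by
    have h := B.det_coe
    rw [Matrix.det_fin_two] at h
    ext
    · linear_combination p.1 * h
    · linear_combination p.2 * h
  right_inv p := by
    have h := B.det_coe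
    rw [Matrix.det_fin_two] at h
    ext
    · linear_combination p.1 * h
    · linear_combination p.2 * h

include hτ in
/-- Homogeneity and modularity of `℘`. -/
lemma wp_moebius (B : SL(2, ℤ)) (z : ℂ) :
    wp (moebius (B : Matrix (Fin 2) (Fin 2) ℤ) τ) z =
      ((B 1 0 : ℂ) * τ + B 1 1) ^ 2 * wp τ (((B 1 0 : ℂ) * τ + B 1 1) * z) := by
  have hd := denom_moebius_ne_zero hτ B
  rw [wp_eq_tsum (moebius_im_pos hτ B), wp_eq_tsum hτ,
    ← (sl2Reindex B).tsum_eq (fun p : ℤ × ℤ ↦ 1 / (((B 1 0 : ℂ) * τ + B 1 1) * z -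
      ((p.1 : ℂ) + p.2 * τ)) ^ 2 - 1 / ((p.1 : ℂ) + p.2 * τ) ^ 2), ← tsum_mul_left]
  refine tsum_congr fun p ↦ ?_
  set j : ℂ := (B 1 0 : ℂ) * τ + B 1 1 with hj
  have h1 : (((sl2Reindex B p).1 : ℂ) + (sl2Reindex B p).2 * τ) =
      j * (p.1 + p.2 * moebius (B : Matrix (Fin 2) (Fin 2) ℤ) τ) := by
    rw [moebius, ← hj, mul_add, mul_div_assoc', mul_div_cancel₀ _ hd]
    simp only [sl2Reindex, Equiv.coe_fn_mk, hj]
    push_cast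
    ring
  rw [h1, ← mul_sub, mul_pow, mul_pow]
  have : j ^ 2 ≠ 0 := pow_ne_zero 2 hd
  rw [mul_sub]
  congr 1 <;> rw [mul_one_div, ← div_div, div_self this]

end wp

section IntegralTaylor

open Polynomial

lemma AnalyticAt.le_analyticOrderAt_of_isBigO {f : ℂ → ℂ} (hf : AnalyticAt ℂ f 0) {n : ℕ}
    (h : f =O[𝓝 0] fun q ↦ q ^ n) : n ≤ analyticOrderAt f 0 := by
  by_contra! hlt
  obtain ⟨m, hm⟩ := ENat.ne_top_iff_exists.mp (ne_top_of_lt hlt)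
  rw [← hm, Nat.cast_lt] at hlt
  obtain ⟨g, hg, hg0, hfg⟩ := hf.analyticOrderAt_eq_natCast.mp hm.symm
  have h1 : (fun q ↦ q ^ m * g q) =O[𝓝[≠] 0] fun q ↦ q ^ m * q ^ (n - m) := by
    refine (h.mono nhdsWithin_le_nhds).congr' (hfg.filter_mono nhdsWithin_le_nhds |>.mono ?_) ?_
    · intro q hq
      simpa using hq
    · exact .of_forall fun q ↦ by simp [← pow_add, Nat.add_sub_cancel' hlt.le]
  have h2 : g =O[𝓝[≠] 0] fun q : ℂ ↦ q ^ (n - m) := by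
    refine ((isBigO_refl (fun q : ℂ ↦ (q ^ m)⁻¹) _).mul h1).congr' ?_ ?_ <;>
    · filter_upwards [self_mem_nhdsWithin] with q hq
      rw [inv_mul_cancel_left₀ (pow_ne_zero _ hq)]
  have h3 : Tendsto (fun q : ℂ ↦ q ^ (n - m)) (𝓝[≠] 0) (𝓝 0) := by
    have : ContinuousAt (fun q : ℂ ↦ q ^ (n - m)) 0 := by fun_prop
    simpa [ContinuousAt, (Nat.sub_pos_of_lt hlt).ne'] using this.tendsto.mono_left
      (nhdsWithin_le_nhds (s := {0}ᶜ))
  exact hg0 (tendsto_nhds_unique (hg.continuousAt.tendsto.mono_left nhdsWithin_le_nhds)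
    (h2.trans_tendsto h3))

variable {R : Subalgebra ℤ ℂ} {H H₁ H₂ : ℂ → ℂ}

/-- `H` is approximated to every order at `0` by polynomials with coefficients in `R`. -/
def IntegralTaylor (R : Subalgebra ℤ ℂ) (H : ℂ → ℂ) : Prop :=
  ∀ k : ℕ, ∃ p : R[X], (fun q ↦ H q - aeval q p) =O[𝓝 0] fun q ↦ q ^ k

lemma iteratedDeriv_aeval_zero (p : R[X]) (n : ℕ) :
    iteratedDeriv n (fun q : ℂ ↦ aeval q p) 0 = n.factorial * p.coeff n := by
  have h : deriv^[n] (fun q : ℂ ↦ aeval q p) = fun q ↦ aeval q (derivative^[n] p) := by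
    induction n with
    | zero => rfl
    | succ n ih =>
      rw [Function.iterate_succ_apply', ih, Function.iterate_succ_apply']
      exact funext fun q ↦ Polynomial.deriv_aeval _
  rw [iteratedDeriv_eq_iterate, h]
  simp only [← Polynomial.coeff_zero_eq_aeval_zero', coeff_iterate_derivative]
  simp [Nat.descFactorial_self]

lemma IntegralTaylor.coeff_mem (h : IntegralTaylor R H) (hH : AnalyticAt ℂ H 0) (n : ℕ) :
    (n.factorial : ℂ)⁻¹ * iteratedDeriv n H 0 ∈ R := by
  obtain ⟨p, hp⟩ := h (n + 1)
  have hpa : AnalyticAt ℂ (fun q : ℂ ↦ aeval q p) 0 := by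
    have : Differentiable ℂ (fun q : ℂ ↦ aeval q p) := p.differentiable_aeval
    exact this.analyticAt 0
  have h0 := (natCast_le_analyticOrderAt_iff_iteratedDeriv_eq_zero (hH.fun_sub hpa)).mp
    ((hH.fun_sub hpa).le_analyticOrderAt_of_isBigO hp) n n.lt_succ_self
  rw [iteratedDeriv_fun_sub hH.contDiffAt hpa.contDiffAt, sub_eq_zero, iteratedDeriv_aeval_zero]
    at h0
  rw [h0, inv_mul_cancel_left₀ (Nat.cast_ne_zero.mpr n.factorial_ne_zero)]
  exact (p.coeff n).2

lemma isBigO_one_aeval (p : R[X]) : (fun q : ℂ ↦ aeval q p) =O[𝓝 0] fun _ ↦ (1 : ℂ) :=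
  (p.differentiable_aeval (𝕜 := ℂ)).continuous.continuousAt.isBigO_one ℂ

lemma IntegralTaylor.isBigO_one (h : IntegralTaylor R H) : H =O[𝓝 0] fun _ ↦ (1 : ℂ) := by
  obtain ⟨p, hp⟩ := h 0
  simp only [pow_zero] at hp
  simpa using hp.add (isBigO_one_aeval p)

lemma IntegralTaylor.mul (h₁ : IntegralTaylor R H₁) (h₂ : IntegralTaylor R H₂) :
    IntegralTaylor R fun q ↦ H₁ q * H₂ q := by
  intro k
  obtain ⟨p₁, hp₁⟩ := h₁ k
  obtain ⟨p₂, hp₂⟩ := h₂ k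
  refine ⟨p₁ * p₂, ?_⟩
  have h := h₁.isBigO_one.mul hp₂
  have h' := hp₁.mul (isBigO_one_aeval p₂)
  simp only [one_mul, mul_one] at h h'
  have := h.add h'
  refine this.congr_left fun q ↦ ?_
  rw [map_mul]
  ring

lemma IntegralTaylor.of_aeval (p : R[X]) : IntegralTaylor R fun q ↦ aeval q p :=
  fun k ↦ ⟨p, by simpa using isBigO_zero _ _⟩

lemma IntegralTaylor.const {a : ℂ} (ha : a ∈ R) : IntegralTaylor R fun _ ↦ a := by
  simpa using IntegralTaylor.of_aeval (C (⟨a, ha⟩ : R))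

lemma IntegralTaylor.one_sub_mul_pow {a : ℂ} (ha : a ∈ R) (m : ℕ) :
    IntegralTaylor R fun q ↦ 1 - a * q ^ m := by
  refine cast (congrArg _ (funext fun q ↦ ?_))
    (IntegralTaylor.of_aeval (1 - C (⟨a, ha⟩ : R) * X ^ m))
  rw [map_sub, map_one, map_mul, aeval_C, map_pow, aeval_X]
  rfl

lemma IntegralTaylor.inv_one_sub_mul_pow {a : ℂ} (ha : a ∈ R) {m : ℕ} (hm : m ≠ 0) :
    IntegralTaylor R fun q ↦ (1 - a * q ^ m)⁻¹ := by
  intro k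
  refine ⟨∑ i ∈ Finset.range k, (C (⟨a, ha⟩ : R) * X ^ m) ^ i, ?_⟩
  have h1 : ContinuousAt (fun q : ℂ ↦ (1 - a * q ^ m)⁻¹ * a ^ k * q ^ ((m - 1) * k)) 0 := by
    have : (1 - a * (0 : ℂ) ^ m) ≠ 0 := by simp [hm]
    fun_prop (disch := exact this)
  have h2 : ∀ᶠ q : ℂ in 𝓝 0, 1 - a * q ^ m ≠ 0 := by
    have : ContinuousAt (fun q : ℂ ↦ 1 - a * q ^ m) 0 := by fun_prop
    exact this.eventually_ne (by simp [hm])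
  have h3 := (h1.isBigO_one ℂ).mul (isBigO_refl (fun q : ℂ ↦ q ^ k) (𝓝 0))
  simp only [one_mul] at h3
  refine h3.congr' ?_ .rfl
  filter_upwards [h2] with q hq
  have h4 := mul_neg_geom_sum (a * q ^ m) k
  have h5 : aeval q (∑ i ∈ Finset.range k, (C (⟨a, ha⟩ : R) * X ^ m) ^ i) =
      ∑ i ∈ Finset.range k, (a * q ^ m) ^ i := by simp
  rw [h5]
  obtain ⟨l, rfl⟩ := Nat.exists_eq_succ_of_ne_zero hm
  field_simp
  rw [h4, Nat.succ_sub_one, Nat.succ_eq_add_one]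
  ring

lemma IntegralTaylor.prod {ι : Type*} (s : Finset ι) {F : ι → ℂ → ℂ}
    (h : ∀ i ∈ s, IntegralTaylor R (F i)) : IntegralTaylor R fun q ↦ ∏ i ∈ s, F i q := by
  classical
  induction s using Finset.induction_on with
  | empty => simpa using IntegralTaylor.const R.one_mem
  | insert i s hi ih =>
    simp only [Finset.prod_insert hi]
    exact (h i (s.mem_insert_self i)).mul (ih fun j hj ↦ h j (Finset.mem_insert_of_mem hj))

lemma IntegralTaylor.of_approx
    (h : ∀ k : ℕ, ∃ G, IntegralTaylor R G ∧ (fun q ↦ H q - G q) =O[𝓝 0] fun q ↦ q ^ k) :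
    IntegralTaylor R H := by
  intro k
  obtain ⟨G, hG, hHG⟩ := h k
  obtain ⟨p, hp⟩ := hG k
  exact ⟨p, by simpa using hHG.add hp⟩

section qPoch

variable {M r : ℕ} {a : ℂ}

lemma isBigO_qPoch_sub_one_self (hM : M ≠ 0) (hr : r ≠ 0) (k : ℕ) :
    (fun q ↦ qPoch (q ^ M) ((q ^ M) ^ k * (a * q ^ r)) - 1) =O[𝓝 0]
      fun q ↦ (q ^ M) ^ k * (a * q ^ r) := by
  have h1 : ∀ᶠ q : ℂ in 𝓝 0, ‖q ^ M‖ ≤ 1 / 2 := by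
    have : ContinuousAt (fun q : ℂ ↦ ‖q ^ M‖) 0 := by fun_prop
    exact (this.eventually_lt continuousAt_const (by simp [hM])).mono fun _ h ↦ h.le
  have h2 : ∀ᶠ q : ℂ in 𝓝 0, ‖(q ^ M) ^ k * (a * q ^ r)‖ ≤ 1 / 2 := by
    have : ContinuousAt (fun q : ℂ ↦ ‖(q ^ M) ^ k * (a * q ^ r)‖) 0 := by fun_prop
    exact (this.eventually_lt continuousAt_const (by simp [hr])).mono fun _ h ↦ h.le
  refine .of_bound 4 ?_
  filter_upwards [h1, h2] with q hq1 hq2 using norm_qPoch_sub_one_le hq1 hq2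

lemma tendsto_qPoch_one (hM : M ≠ 0) (hr : r ≠ 0) (k : ℕ) :
    Tendsto (fun q ↦ qPoch (q ^ M) ((q ^ M) ^ k * (a * q ^ r))) (𝓝 0) (𝓝 1) := by
  have h : ContinuousAt (fun q : ℂ ↦ (q ^ M) ^ k * (a * q ^ r)) 0 := by fun_prop
  have h0 := (isBigO_qPoch_sub_one_self (a := a) hM hr k).trans_tendsto
    (by simpa [ContinuousAt, hr] using h)
  simpa using h0.add_const 1

lemma isBigO_qPoch_sub_one (hM : M ≠ 0) (hr : r ≠ 0) (k : ℕ) :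
    (fun q ↦ qPoch (q ^ M) ((q ^ M) ^ k * (a * q ^ r)) - 1) =O[𝓝 0] fun q ↦ q ^ k := by
  refine (isBigO_qPoch_sub_one_self hM hr k).trans ?_
  obtain ⟨l, rfl⟩ := Nat.exists_eq_succ_of_ne_zero hM
  have h4 : ContinuousAt (fun q : ℂ ↦ q ^ (l * k) * (a * q ^ r)) 0 := by fun_prop
  have h5 := (h4.isBigO_one ℂ).mul (isBigO_refl (fun q : ℂ ↦ q ^ k) (𝓝 0))
  simp only [one_mul] at h5
  refine h5.congr_left fun q ↦ ?_
  rw [Nat.succ_eq_add_one]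
  ring

lemma eventually_norm_pow_lt_one (hM : M ≠ 0) : ∀ᶠ q : ℂ in 𝓝 0, ‖q ^ M‖ < 1 := by
  have : ContinuousAt (fun q : ℂ ↦ ‖q ^ M‖) 0 := by fun_prop
  exact this.eventually_lt continuousAt_const (by simp [hM])

lemma integralTaylor_prod_one_sub (ha : a ∈ R) (k : ℕ) :
    IntegralTaylor R fun q ↦ ∏ n ∈ Finset.range k, (1 - (q ^ M) ^ n * (a * q ^ r)) := by
  refine .prod _ fun n _ ↦ ?_
  have := IntegralTaylor.one_sub_mul_pow ha (M * n + r)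
  refine cast (congrArg _ (funext fun q ↦ ?_)) this
  ring

lemma integralTaylor_prod_one_sub_inv (ha : a ∈ R) (hr : r ≠ 0) (k : ℕ) :
    IntegralTaylor R fun q ↦ (∏ n ∈ Finset.range k, (1 - (q ^ M) ^ n * (a * q ^ r)))⁻¹ := by
  simp only [← Finset.prod_inv_distrib]
  refine .prod _ fun n _ ↦ ?_
  have := IntegralTaylor.inv_one_sub_mul_pow ha (m := M * n + r) (by omega)
  refine cast (congrArg _ (funext fun q ↦ ?_)) this
  ring

lemma integralTaylor_qPoch (ha : a ∈ R) (hM : M ≠ 0) (hr : r ≠ 0) :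
    IntegralTaylor R fun q ↦ qPoch (q ^ M) (a * q ^ r) := by
  refine .of_approx fun k ↦ ⟨_, integralTaylor_prod_one_sub (M := M) (r := r) ha k, ?_⟩
  have := (integralTaylor_prod_one_sub (M := M) (r := r) ha k).isBigO_one.mul
    (isBigO_qPoch_sub_one (a := a) hM hr k)
  simp only [one_mul] at this
  refine this.congr' ?_ .rfl
  filter_upwards [eventually_norm_pow_lt_one hM] with q hq
  rw [qPoch_eq_prod_mul hq (a * q ^ r) k]
  ring

lemma integralTaylor_qPoch_inv (ha : a ∈ R) (hM : M ≠ 0) (hr : r ≠ 0) :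
    IntegralTaylor R fun q ↦ (qPoch (q ^ M) (a * q ^ r))⁻¹ := by
  refine .of_approx fun k ↦ ⟨_, integralTaylor_prod_one_sub_inv (M := M) ha hr k, ?_⟩
  have hT := isBigO_qPoch_sub_one (a := a) hM hr k
  have hT1 := tendsto_qPoch_one (a := a) hM hr k
  have hT2 := hT1.inv₀ one_ne_zero
  have := ((integralTaylor_prod_one_sub_inv (M := M) ha hr k).isBigO_one.mul
    (hT2.isBigO_one ℂ)).mul hT.neg_left
  simp only [one_mul] at this
  refine this.congr' ?_ .rfl
  filter_upwards [eventually_norm_pow_lt_one hM, hT1.eventually_ne one_ne_zero] with q hq h0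
  rw [qPoch_eq_prod_mul hq (a * q ^ r) k, mul_inv]
  linear_combination
    -(∏ n ∈ Finset.range k, (1 - (q ^ M) ^ n * (a * q ^ r)))⁻¹ * (inv_mul_cancel₀ h0)

end qPoch

end IntegralTaylor

section IsUnitExpansion

/-- Near `i∞`, the function `F` is a power of `q` times a unit power series in `q` over `R`. -/
def IsUnitExpansion (R : Subalgebra ℤ ℂ) (N : ℕ) (F : ℂ → ℂ) : Prop :=
  ∃ (t : ℤ) (H : ℂ → ℂ), DifferentiableOn ℂ H (Metric.ball 0 1) ∧
    (∀ q ∈ Metric.ball (0 : ℂ) 1, H q ≠ 0) ∧ IntegralTaylor R H ∧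
    IntegralTaylor R (fun q ↦ (H q)⁻¹) ∧
    ∀ τ : ℂ, 0 < τ.im → F τ = qq N τ ^ t * H (qq N τ)

lemma qq_eq (N : ℕ) (τ : ℂ) : qq N τ = 𝐞 (τ / N) := by rw [qq, cexpTwoPi, mul_div_assoc]

lemma zetaN_eq (N : ℕ) : zetaN N = 𝐞 (1 / N) := by rw [zetaN, cexpTwoPi, mul_one_div]

lemma qq_ne_zero (N : ℕ) (τ : ℂ) : qq N τ ≠ 0 := exp_ne_zero _

lemma zetaN_ne_zero (N : ℕ) : zetaN N ≠ 0 := exp_ne_zero _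

lemma norm_qq_lt_one {N : ℕ} (hN : N ≠ 0) {τ : ℂ} (hτ : 0 < τ.im) : ‖qq N τ‖ < 1 := by
  rw [qq_eq]
  refine norm_cexpTwoPi_lt_one ?_
  rw [Complex.div_natCast_im]
  positivity

variable {R : Subalgebra ℤ ℂ} {N : ℕ} {F G : ℂ → ℂ}

lemma IsUnitExpansion.congr (h : IsUnitExpansion R N F) (hFG : ∀ τ : ℂ, 0 < τ.im → G τ = F τ) :
    IsUnitExpansion R N G := by
  obtain ⟨t, H, h1, h2, h3, h4, h5⟩ := h
  exact ⟨t, H, h1, h2, h3, h4, fun τ hτ ↦ (hFG τ hτ).trans (h5 τ hτ)⟩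

lemma IsUnitExpansion.mul (hF : IsUnitExpansion R N F) (hG : IsUnitExpansion R N G) :
    IsUnitExpansion R N fun τ ↦ F τ * G τ := by
  obtain ⟨t, H, h1, h2, h3, h4, h5⟩ := hF
  obtain ⟨s, K, k1, k2, k3, k4, k5⟩ := hG
  refine ⟨t + s, fun q ↦ H q * K q, h1.mul k1, fun q hq ↦ mul_ne_zero (h2 q hq) (k2 q hq),
    h3.mul k3, by simpa only [mul_inv] using h4.mul k4, fun τ hτ ↦ ?_⟩
  beta_reduce
  rw [h5 τ hτ, k5 τ hτ, zpow_add₀ (qq_ne_zero N τ)]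
  ring

lemma IsUnitExpansion.inv (hF : IsUnitExpansion R N F) :
    IsUnitExpansion R N fun τ ↦ (F τ)⁻¹ := by
  obtain ⟨t, H, h1, h2, h3, h4, h5⟩ := hF
  refine ⟨-t, fun q ↦ (H q)⁻¹, h1.inv h2, fun q hq ↦ inv_ne_zero (h2 q hq), h4,
    by simpa only [inv_inv] using h3, fun τ hτ ↦ ?_⟩
  beta_reduce
  rw [h5 τ hτ, zpow_neg, mul_inv]

lemma IsUnitExpansion.div (hF : IsUnitExpansion R N F) (hG : IsUnitExpansion R N G) :
    IsUnitExpansion R N fun τ ↦ F τ / G τ := by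
  simpa only [div_eq_mul_inv] using hF.mul hG.inv

lemma IsUnitExpansion.const {a : ℂ} (ha : a ∈ R) (ha' : a⁻¹ ∈ R) (h0 : a ≠ 0) :
    IsUnitExpansion R N fun _ ↦ a :=
  ⟨0, fun _ ↦ a, differentiableOn_const _, fun _ _ ↦ h0, .const ha, .const ha',
    fun τ _ ↦ by simp⟩

lemma isUnitExpansion_qq_zpow (t : ℤ) : IsUnitExpansion R N fun τ ↦ qq N τ ^ t :=
  ⟨t, fun _ ↦ 1, differentiableOn_const _, fun _ _ ↦ one_ne_zero, .const R.one_mem,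
    by simpa using IntegralTaylor.const R.one_mem, fun τ _ ↦ by simp⟩

lemma isUnitExpansion_qPoch (hN : N ≠ 0) {a : ℂ} (ha : a ∈ R) (ha1 : ‖a‖ = 1) {r : ℕ}
    (hr : r ≠ 0) : IsUnitExpansion R N fun τ ↦ qPoch (qq N τ ^ N) (a * qq N τ ^ r) := by
  have hlt {q : ℂ} (hq : q ∈ Metric.ball (0 : ℂ) 1) {m : ℕ} (hm : m ≠ 0) : ‖q ^ m‖ < 1 := by
    rw [norm_pow]
    exact pow_lt_one₀ (norm_nonneg _) (by simpa using hq) hm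
  refine ⟨0, fun q ↦ qPoch (q ^ N) (a * q ^ r), ?_, fun q hq ↦ ?_, integralTaylor_qPoch ha hN hr,
    integralTaylor_qPoch_inv ha hN hr, fun τ _ ↦ by simp⟩
  · exact differentiableOn_qPoch_comp Metric.isOpen_ball (by fun_prop) (by fun_prop)
      fun q hq ↦ hlt hq hN
  · refine qPoch_ne_zero (hlt hq hN) fun n hn ↦ ?_
    have h := congrArg norm hn
    rw [norm_mul, norm_mul, ha1, one_mul, norm_one, ← norm_mul, ← pow_mul, ← pow_add] at h
    exact (hlt hq (by omega)).ne h

lemma IsUnitExpansion.exists_hasSum (hN : N ≠ 0) (h : IsUnitExpansion R N F) :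
    ∃ (n₀ : ℤ) (c : ℤ → ℂ), (∀ m, c m ∈ R) ∧ (∀ m < n₀, c m = 0) ∧
      ∀ τ : ℂ, 0 < τ.im → HasSum (fun m ↦ c m * qq N τ ^ m) (F τ) := by
  obtain ⟨t, H, h1, -, h3, -, h5⟩ := h
  have ha : AnalyticAt ℂ H 0 := h1.analyticAt (Metric.ball_mem_nhds 0 one_pos)
  refine ⟨t, fun m ↦ if t ≤ m then
    ((m - t).toNat.factorial : ℂ)⁻¹ * iteratedDeriv (m - t).toNat H 0 else 0,
    fun m ↦ ?_, fun m hm ↦ if_neg hm.not_ge, fun τ hτ ↦ ?_⟩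
  · beta_reduce
    split_ifs
    exacts [h3.coeff_mem ha _, R.zero_mem]
  · have hs := (Complex.hasSum_taylorSeries_on_ball h1
      (show qq N τ ∈ Metric.ball 0 1 by simpa using norm_qq_lt_one hN hτ)).mul_left (qq N τ ^ t)
    rw [← h5 τ hτ] at hs
    have hi : Function.Injective fun n : ℕ ↦ (n : ℤ) + t := fun m n hmn ↦ by simpa using hmn
    refine (hi.hasSum_iff fun m hm ↦ ?_).mp (hs.congr_fun ?_)
    · beta_reduce
      rw [if_neg, zero_mul]
      exact fun htm ↦ hm ⟨(m - t).toNat, by simp [htm]⟩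
    · intro n
      simp only [Function.comp_apply, add_sub_cancel_right, Int.toNat_natCast, sub_zero,
        smul_eq_mul, zpow_add₀ (qq_ne_zero N τ), zpow_natCast]
      rw [if_pos (by omega)]
      ring

end IsUnitExpansion

section zetaN

variable {N : ℕ}

lemma isPrimitiveRoot_zetaN (hN : N ≠ 0) : IsPrimitiveRoot (zetaN N) N :=
  Complex.isPrimitiveRoot_exp N hN

/-- The ring `ℤ[ζ]`. -/
noncomputable abbrev zetaRing (N : ℕ) : Subalgebra ℤ ℂ := Algebra.adjoin ℤ {zetaN N}

lemma exists_zetaN_zpow_eq_pow (hN : N ≠ 0) (y : ℤ) : ∃ n : ℕ, zetaN N ^ y = zetaN N ^ n := by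
  refine ⟨(y % N).toNat, ?_⟩
  have h := (isPrimitiveRoot_zetaN hN).zpow_eq_one
  rw [← zpow_natCast, Int.toNat_of_nonneg (Int.emod_nonneg _ (by exact_mod_cast hN))]
  conv_lhs => rw [← Int.mul_ediv_add_emod y N]
  rw [zpow_add₀ (zetaN_ne_zero N), zpow_mul, h, one_zpow, one_mul]

lemma zetaN_zpow_mem (hN : N ≠ 0) (y : ℤ) : zetaN N ^ y ∈ zetaRing N := by
  obtain ⟨n, hn⟩ := exists_zetaN_zpow_eq_pow hN y
  rw [hn]
  exact pow_mem (Algebra.self_mem_adjoin_singleton ℤ _) n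

lemma norm_zetaN_zpow (hN : N ≠ 0) (y : ℤ) : ‖zetaN N ^ y‖ = 1 := by
  rw [norm_zpow, (isPrimitiveRoot_zetaN hN).norm'_eq_one hN, one_zpow]

lemma one_sub_pow_div_mem {R : Subalgebra ℤ ℂ} {w : ℂ} (hw : w ∈ R) (n : ℕ) :
    (1 - w ^ n) / (1 - w) ∈ R := by
  by_cases h : w = 1
  · simp [h]
  · rw [← mul_neg_geom_sum, mul_div_cancel_left₀ _ (sub_ne_zero.mpr (Ne.symm h))]
    exact sum_mem fun i _ ↦ pow_mem hw i

lemma isUnitExpansion_one_sub_zetaN_zpow_div (hN : 2 ≤ N) {y : ℤ} (hy : IsCoprime y N) :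
    IsUnitExpansion (zetaRing N) N fun _ ↦ (1 - zetaN N)⁻¹ * (1 - zetaN N ^ y) := by
  have hN0 : N ≠ 0 := by omega
  have hζ := isPrimitiveRoot_zetaN hN0
  obtain ⟨n, hn⟩ := exists_zetaN_zpow_eq_pow hN0 y
  obtain ⟨u, v, huv⟩ := hy
  obtain ⟨m, hm⟩ : ∃ m : ℕ, (zetaN N ^ y) ^ m = zetaN N := by
    obtain ⟨m, hm⟩ := exists_zetaN_zpow_eq_pow hN0 u
    refine ⟨m, ?_⟩
    rw [← zpow_natCast, ← zpow_mul, mul_comm, zpow_mul, zpow_natCast, ← hm, ← zpow_mul,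
      show u * y = 1 - N * v by linear_combination huv, zpow_sub₀ (zetaN_ne_zero N), zpow_mul,
      hζ.zpow_eq_one, one_zpow, zpow_one, div_one]
  have h1 : 1 - zetaN N ≠ 0 := sub_ne_zero.mpr (hζ.ne_one (by omega)).symm
  have h2 : 1 - zetaN N ^ y ≠ 0 := by
    refine sub_ne_zero.mpr fun h ↦ h1 ?_
    rw [← hm, ← h, one_pow, sub_self]
  refine .const ?_ ?_ (mul_ne_zero (inv_ne_zero h1) h2)
  · rw [hn, mul_comm, ← div_eq_mul_inv]
    exact one_sub_pow_div_mem (Algebra.self_mem_adjoin_singleton ℤ _) n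
  · have := one_sub_pow_div_mem (zetaN_zpow_mem hN0 y) m
    rwa [hm, ← inv_div, div_eq_inv_mul] at this

lemma isUnitExpansion_thetaProd_periodic (hN : N ≠ 0) (κ : ℂ) (y : ℤ) :
    Function.Periodic (fun x : ℤ ↦ IsUnitExpansion (zetaRing N) N
      fun τ ↦ κ * thetaProd (qq N τ ^ N) (zetaN N ^ y * qq N τ ^ x)) N := by
  intro x
  have hu : IsUnitExpansion (zetaRing N) N fun τ ↦ -(zetaN N ^ y * qq N τ ^ x)⁻¹ := by
    have h1 : IsUnitExpansion (zetaRing N) N fun _ ↦ -(zetaN N ^ y)⁻¹ := by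
      refine .const ?_ ?_ (neg_ne_zero.mpr (inv_ne_zero (zpow_ne_zero _ (zetaN_ne_zero N))))
      · simpa only [← zpow_neg] using neg_mem (zetaN_zpow_mem hN (-y))
      · simpa only [inv_neg, inv_inv] using neg_mem (zetaN_zpow_mem hN y)
    refine (h1.mul (isUnitExpansion_qq_zpow x).inv).congr fun τ _ ↦ ?_
    rw [mul_inv, neg_mul]
  have hθ (τ : ℂ) (hτ : 0 < τ.im) :
      κ * thetaProd (qq N τ ^ N) (zetaN N ^ y * qq N τ ^ (x + N)) =
        -(zetaN N ^ y * qq N τ ^ x)⁻¹ *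
          (κ * thetaProd (qq N τ ^ N) (zetaN N ^ y * qq N τ ^ x)) := by
    have hq := qq_ne_zero N τ
    rw [zpow_add₀ hq, zpow_natCast, ← mul_assoc, mul_comm _ (qq N τ ^ N), thetaProd_mul _
      (pow_ne_zero _ hq) (mul_ne_zero (zpow_ne_zero _ (zetaN_ne_zero N)) (zpow_ne_zero _ hq))]
    · ring
    · rw [norm_pow]
      exact pow_lt_one₀ (norm_nonneg _) (norm_qq_lt_one hN hτ) hN
  refine propext ⟨fun h ↦ (hu.inv.mul h).congr fun τ hτ ↦ ?_, fun h ↦ (hu.mul h).congr hθ⟩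
  rw [hθ τ hτ, inv_mul_cancel_left₀]
  exact neg_ne_zero.mpr (inv_ne_zero
    (mul_ne_zero (zpow_ne_zero _ (zetaN_ne_zero N)) (zpow_ne_zero _ (qq_ne_zero N τ))))

lemma isUnitExpansion_thetaProd_emod_iff (hN : N ≠ 0) (κ : ℂ) (x y : ℤ) :
    (IsUnitExpansion (zetaRing N) N
      fun τ ↦ κ * thetaProd (qq N τ ^ N) (zetaN N ^ y * qq N τ ^ (x % N))) ↔
    IsUnitExpansion (zetaRing N) N
      fun τ ↦ κ * thetaProd (qq N τ ^ N) (zetaN N ^ y * qq N τ ^ x) := by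
  have h := (isUnitExpansion_thetaProd_periodic hN κ y).int_mul (x / N) (x % N)
  rw [Int.cast_id, Int.emod_add_ediv_mul] at h
  exact (iff_of_eq h).symm

lemma isUnitExpansion_thetaProd_of_not_dvd (hN : N ≠ 0) {x : ℤ} (hx : ¬ (N : ℤ) ∣ x) (y : ℤ) :
    IsUnitExpansion (zetaRing N) N
      fun τ ↦ thetaProd (qq N τ ^ N) (zetaN N ^ y * qq N τ ^ x) := by
  have hper := isUnitExpansion_thetaProd_emod_iff hN 1 x y
  simp only [one_mul] at hper
  rw [← hper]
  have hN' : (0 : ℤ) < N := by exact_mod_cast Nat.pos_of_ne_zero hN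
  obtain ⟨r, hr⟩ := Int.eq_ofNat_of_zero_le (Int.emod_nonneg x hN'.ne')
  have hr0 : r ≠ 0 := by
    rintro rfl
    exact hx (Int.dvd_of_emod_eq_zero hr)
  have hrN : r < N := by exact_mod_cast hr ▸ Int.emod_lt_of_pos x hN'
  rw [hr]
  refine ((isUnitExpansion_qPoch hN (zetaN_zpow_mem hN y) (norm_zetaN_zpow hN y) hr0).mul
    (isUnitExpansion_qPoch hN (zetaN_zpow_mem hN (-y)) (norm_zetaN_zpow hN (-y))
      (Nat.sub_ne_zero_of_lt hrN))).congr fun τ _ ↦ ?_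
  rw [thetaProd, zpow_natCast, zpow_neg, pow_sub₀ _ (qq_ne_zero N τ) hrN.le]
  congr 2
  field_simp

lemma isUnitExpansion_thetaProd_of_dvd (hN : 2 ≤ N) {x : ℤ} (hx : (N : ℤ) ∣ x) {y : ℤ}
    (hy : IsCoprime y N) : IsUnitExpansion (zetaRing N) N
      fun τ ↦ (1 - zetaN N)⁻¹ * thetaProd (qq N τ ^ N) (zetaN N ^ y * qq N τ ^ x) := by
  have hN0 : N ≠ 0 := by omega
  rw [← isUnitExpansion_thetaProd_emod_iff hN0, Int.emod_eq_zero_of_dvd hx]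
  refine ((isUnitExpansion_one_sub_zetaN_zpow_div hN hy).mul
    ((isUnitExpansion_qPoch hN0 (zetaN_zpow_mem hN0 y) (norm_zetaN_zpow hN0 y) hN0).mul
    (isUnitExpansion_qPoch hN0 (zetaN_zpow_mem hN0 (-y)) (norm_zetaN_zpow hN0 (-y))
      hN0))).congr fun τ hτ ↦ ?_
  have hQ : ‖qq N τ ^ N‖ < 1 := by
    rw [norm_pow]
    exact pow_lt_one₀ (norm_nonneg _) (norm_qq_lt_one hN0 hτ) hN0
  rw [thetaProd, zpow_zero, mul_one, qPoch_eq_mul hQ (zetaN N ^ y), zpow_neg,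
    mul_comm (zetaN N ^ y) (qq N τ ^ N), div_eq_mul_inv, mul_comm (zetaN N ^ y)⁻¹]
  ring

end zetaN

section Wfun

variable {N : ℕ} {B : SL(2, ℤ)} {s t u : ℤ}

/-- The division point `s (cτ + d) / N`, where `(c, d)` is the bottom row of `B`. -/
noncomputable def divPoint (N : ℕ) (B : SL(2, ℤ)) (s : ℤ) (τ : ℂ) : ℂ :=
  ((B 1 0 : ℂ) * τ + B 1 1) * (s / N)

lemma divPoint_add (τ : ℂ) : divPoint N B (s + t) τ = divPoint N B s τ + divPoint N B t τ := by
  simp only [divPoint]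
  push_cast
  ring

lemma divPoint_sub (τ : ℂ) : divPoint N B (s - t) τ = divPoint N B s τ - divPoint N B t τ := by
  simp only [divPoint]
  push_cast
  ring

lemma cexpTwoPi_eq_qq_pow (hN : N ≠ 0) (τ : ℂ) : 𝐞 τ = qq N τ ^ N := by
  have : (N : ℂ) ≠ 0 := Nat.cast_ne_zero.mpr hN
  rw [qq_eq, ← zpow_natCast, ← cexpTwoPi_int_mul, Int.cast_natCast, mul_div_cancel₀ _ this]

lemma cexpTwoPi_divPoint (τ : ℂ) :
    𝐞 (divPoint N B s τ) = zetaN N ^ (s * B 1 1) * qq N τ ^ (s * B 1 0) := by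
  rw [zetaN_eq, qq_eq, ← cexpTwoPi_int_mul, ← cexpTwoPi_int_mul, ← cexpTwoPi_add, divPoint]
  push_cast
  ring_nf

lemma isCoprime_bottom_row (B : SL(2, ℤ)) : IsCoprime (B 1 0) (B 1 1) := by
  have h := B.det_coe
  rw [Matrix.det_fin_two] at h
  exact ⟨-B 0 1, B 0 0, by linear_combination h⟩

lemma divPoint_notMem_lattice (hN : 2 ≤ N) (hs : IsCoprime s N) {τ : ℂ} (hτ : 0 < τ.im) :
    divPoint N B s τ ∉ (stdPeriodPair τ hτ).lattice := by
  rw [mem_stdPeriodPair_lattice]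
  rintro ⟨m, n, h⟩
  have hN0 : (N : ℂ) ≠ 0 := by
    rw [Nat.cast_ne_zero]
    omega
  rw [divPoint, mul_div_assoc', eq_div_iff hN0] at h
  have him : ((n * N - B 1 0 * s : ℤ) : ℝ) = 0 := by
    have := congrArg im h
    simp at this
    push_cast
    refine (mul_eq_zero.mp ?_).resolve_right hτ.ne'
    linear_combination this
  have hn : n * N = B 1 0 * s := sub_eq_zero.mp (by exact_mod_cast him)
  have hm : m * N = B 1 1 * s := by
    have hn' : (n * N : ℂ) = B 1 0 * s := by exact_mod_cast hn
    have : (m * N : ℂ) = B 1 1 * s := by linear_combination h - τ * hn'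
    exact_mod_cast this
  have h10 : (N : ℤ) ∣ B 1 0 := hs.symm.dvd_of_dvd_mul_right ⟨n, by rw [← hn, mul_comm]⟩
  have h11 : (N : ℤ) ∣ B 1 1 := hs.symm.dvd_of_dvd_mul_right ⟨m, by rw [← hm, mul_comm]⟩
  have := (isCoprime_bottom_row B).isUnit_of_dvd' h10 h11
  rw [Int.isUnit_iff] at this
  omega

lemma exists_isUnitExpansion_thetaAdd (hN : 2 ≤ N) (B : SL(2, ℤ)) :
    ∃ κ : ℂ, κ ≠ 0 ∧ ∀ s : ℤ, IsCoprime s N →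
      IsUnitExpansion (zetaRing N) N fun τ ↦ κ * thetaAdd τ (divPoint N B s τ) := by
  have hN0 : N ≠ 0 := by omega
  have hθ (s : ℤ) (τ : ℂ) : thetaAdd τ (divPoint N B s τ) =
      thetaProd (qq N τ ^ N) (zetaN N ^ (s * B 1 1) * qq N τ ^ (s * B 1 0)) := by
    rw [thetaAdd, cexpTwoPi_eq_qq_pow hN0, cexpTwoPi_divPoint]
  simp only [hθ]
  by_cases h : (N : ℤ) ∣ B 1 0
  · refine ⟨(1 - zetaN N)⁻¹, inv_ne_zero (sub_ne_zero.mpr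
      ((isPrimitiveRoot_zetaN hN0).ne_one (by omega)).symm), fun s hs ↦ ?_⟩
    exact isUnitExpansion_thetaProd_of_dvd hN (h.mul_left s)
      (hs.mul_left ((isCoprime_bottom_row B).of_isCoprime_of_dvd_left h).symm)
  · refine ⟨1, one_ne_zero, fun s hs ↦ ?_⟩
    simpa only [one_mul] using isUnitExpansion_thetaProd_of_not_dvd hN0
      (fun hd ↦ h (hs.symm.dvd_of_dvd_mul_left hd)) _

lemma exists_wp_moebius_sub_eq (hN : 2 ≤ N) (hu : IsCoprime u N) (B : SL(2, ℤ)) {τ : ℂ}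
    (hτ : 0 < τ.im) : ∃ c : ℂ, c ≠ 0 ∧ ∀ s : ℤ, IsCoprime s N →
      wp (moebius (B : Matrix (Fin 2) (Fin 2) ℤ) τ) (s / N) -
        wp (moebius (B : Matrix (Fin 2) (Fin 2) ℤ) τ) (u / N) =
      c * (thetaAdd τ (divPoint N B (s + u) τ) * thetaAdd τ (divPoint N B (s - u) τ) /
        thetaAdd τ (divPoint N B s τ) ^ 2) := by
  obtain ⟨c, hc, h⟩ := exists_thetaAdd_quotient_eq hτ (divPoint_notMem_lattice (B := B) hN hu hτ)
  refine ⟨((B 1 0 : ℂ) * τ + B 1 1) ^ 2 * c⁻¹,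
    mul_ne_zero (pow_ne_zero 2 (denom_moebius_ne_zero hτ B)) (inv_ne_zero hc), fun s hs ↦ ?_⟩
  rw [divPoint_add, divPoint_sub, h _ (divPoint_notMem_lattice hN hs hτ), mul_assoc,
    inv_mul_cancel_left₀ hc, wp_moebius hτ, wp_moebius hτ, wp_eq_weierstrassP hτ,
    wp_eq_weierstrassP hτ, ← mul_sub]
  rfl

theorem isUnitExpansion_Wfun_moebius (hN : 2 ≤ N) (hs : IsCoprime s N) (ht : IsCoprime t N)
    (hu : IsCoprime u N) (hsu : IsCoprime (s - u) N) (hsu' : IsCoprime (s + u) N)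
    (htu : IsCoprime (t - u) N) (htu' : IsCoprime (t + u) N) (B : SL(2, ℤ)) :
    IsUnitExpansion (zetaRing N) N
      fun τ ↦ Wfun N s t u (moebius (B : Matrix (Fin 2) (Fin 2) ℤ) τ) := by
  obtain ⟨κ, hκ, h⟩ := exists_isUnitExpansion_thetaAdd hN B
  refine (((h _ hsu').mul (h _ hsu)).div ((h _ hs).mul (h _ hs))).div
    (((h _ htu').mul (h _ htu)).div ((h _ ht).mul (h _ ht))) |>.congr fun τ hτ ↦ ?_
  obtain ⟨c, hc, hW⟩ := exists_wp_moebius_sub_eq hN hu B hτ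
  have hκ2 : κ * κ ≠ 0 := mul_ne_zero hκ hκ
  rw [Wfun, hW s hs, hW t ht, mul_div_mul_left _ _ hc]
  simp only [mul_mul_mul_comm κ, mul_div_mul_left _ _ hκ2, pow_two]

end Wfun

/-- for odd `N` and `𝔞 ∈ 𝔈₂`, for every `B ∈ SL₂(ℤ)` the function
`τ ↦ W_𝔞(B·τ)` has a `q`-expansion with coefficients in `ℤ[ζ]`. -/
theorem stmt15 (N : ℕ) (hN : 0 < N) (hodd : Odd N)
    (a : ℤ × ℤ × ℤ) (ha : memE2 N a) (B : SL(2, ℤ)) :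
    ∃ (n₀ : ℤ) (c : ℤ → ℂ),
      (∀ m : ℤ, c m ∈ Algebra.adjoin ℤ ({zetaN N} : Set ℂ)) ∧
      (∀ m : ℤ, m < n₀ → c m = 0) ∧
      ∀ τ : ℂ, 0 < τ.im →
        Summable (fun m : ℤ => c m * qq N τ ^ m) ∧
        Wfun N a.1 a.2.1 a.2.2 (moebius ((B : SL(2, ℤ)) : Matrix (Fin 2) (Fin 2) ℤ) τ) =
          ∑' m : ℤ, c m * qq N τ ^ m := by
  obtain ⟨⟨hE, hcop⟩, h1, h2, h3, h4⟩ := ha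
  have hN2 : 2 ≤ N := by
    obtain ⟨h, -, -, h', -⟩ := hE
    omega
  have hu := hcop.of_mul_left_right
  have hs := hcop.of_mul_left_left.of_mul_left_left
  have ht := hcop.of_mul_left_left.of_mul_left_right
  obtain ⟨n₀, c, hc, hc0, h⟩ :=
    (isUnitExpansion_Wfun_moebius hN2 hs ht hu h1 h2 h3 h4 B).exists_hasSum hN.ne'
  exact ⟨n₀, c, hc, hc0, fun τ hτ ↦ ⟨(h τ hτ).summable, (h τ hτ).tsum_eq.symm⟩⟩
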